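/- The second derivatives ∂²ₓₓφ and ∂²ₓₓψ vanish identically, and for every Lebesgue-integrable function q : [0,c] → ℝ one has ∫_T q(y)·∂²ₓᵧφ(x,y) dx dy + ∫_K q(y)·∂²ₓᵧψ(x,y) dx dy = 0. -/

import Mathlib

open MvPolynomial MeasureTheory

/-- The Adini shape-function space `𝒜 = P₃ + span{x³y, xy³}`, spanned by the
twelve monomials `1, x, y, x², xy, y², x³, x²y, xy², y³, x³y, xy³`. -/
noncomputable def AdiniSpace : Submodule ℝ (MvPolynomial (Fin 2) ℝ) :=
  Submodule.span ℝ
    ({1, X 0, X 1, X 0 ^ 2, X 0 * X 1, X 1 ^ 2, X 0 ^ 3, X 0 ^ 2 * X 1,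
      X 0 * X 1 ^ 2, X 1 ^ 3, X 0 ^ 3 * X 1, X 0 * X 1 ^ 3} :
      Set (MvPolynomial (Fin 2) ℝ))

/-- Evaluation of a polynomial in the two variables at the point `(x, y)`. -/
noncomputable def pev (x y : ℝ) (p : MvPolynomial (Fin 2) ℝ) : ℝ :=
  eval ![x, y] p

/-- Partial derivative `∂ₓ`. -/
noncomputable def dX : MvPolynomial (Fin 2) ℝ → MvPolynomial (Fin 2) ℝ :=
  pderiv (0 : Fin 2)

/-- Partial derivative `∂_y`. -/
noncomputable def dY : MvPolynomial (Fin 2) ℝ → MvPolynomial (Fin 2) ℝ :=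
  pderiv (1 : Fin 2)

/-- The Adini degree of freedom at a vertex `v` with multi-index
`β = 0 ↔ (0,0)` (point value), `β = 1 ↔ (1,0)` (`∂ₓ`), `β = 2 ↔ (0,1)` (`∂_y`). -/
noncomputable def adiniDof (β : Fin 3) (v : ℝ × ℝ) (p : MvPolynomial (Fin 2) ℝ) : ℝ :=
  if β = 0 then pev v.1 v.2 p else if β = 1 then pev v.1 v.2 (dX p) else pev v.1 v.2 (dY p)

/-- Vertices of the reference square `[−1,1]²`:
`z₁ = (−1,−1)`, `z₂ = (1,−1)`, `z₃ = (1,1)`, `z₄ = (−1,1)`. -/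
noncomputable def refVertex : Fin 4 → ℝ × ℝ := ![(-1, -1), (1, -1), (1, 1), (-1, 1)]

theorem AdiniSpace.exists_coeffs {p : MvPolynomial (Fin 2) ℝ} (hp : p ∈ AdiniSpace) :
    ∃ k : Fin 12 → ℝ, p = C (k 0) + C (k 1) * X 0 + C (k 2) * X 1 + C (k 3) * X 0 ^ 2
      + C (k 4) * (X 0 * X 1) + C (k 5) * X 1 ^ 2 + C (k 6) * X 0 ^ 3
      + C (k 7) * (X 0 ^ 2 * X 1) + C (k 8) * (X 0 * X 1 ^ 2) + C (k 9) * X 1 ^ 3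
      + C (k 10) * (X 0 ^ 3 * X 1) + C (k 11) * (X 0 * X 1 ^ 3) := by
  unfold AdiniSpace at hp
  simp only [Submodule.mem_span_insert, Submodule.mem_span_singleton] at hp
  obtain ⟨k₀, _, ⟨k₁, _, ⟨k₂, _, ⟨k₃, _, ⟨k₄, _, ⟨k₅, _, ⟨k₆, _, ⟨k₇, _, ⟨k₈, _, ⟨k₉, _,
    ⟨k₁₀, _, ⟨k₁₁, rfl⟩, rfl⟩, rfl⟩, rfl⟩, rfl⟩, rfl⟩, rfl⟩, rfl⟩, rfl⟩, rfl⟩, rfl⟩, rfl⟩ := hp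
  refine ⟨![k₀, k₁, k₂, k₃, k₄, k₅, k₆, k₇, k₈, k₉, k₁₀, k₁₁], ?_⟩
  simp only [smul_eq_C_mul, Matrix.cons_val]
  ring

/-- The Adini basis function of the degree of freedom `∂_y` at the origin, on the rectangle with
opposite vertex `(s, c)`, is `(1 - x / s) * (y - 2 * y ^ 2 / c + y ^ 3 / c ^ 2)`. -/
theorem AdiniSpace.eq_of_dof {s c : ℝ} (hs : s ≠ 0) (hc : c ≠ 0)
    {p : MvPolynomial (Fin 2) ℝ} (hp : p ∈ AdiniSpace)
    (h₀ : ∀ β : Fin 3, adiniDof β (0, 0) p = if β = 2 then 1 else 0)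
    (hv : ∀ β : Fin 3,
      adiniDof β (s, 0) p = 0 ∧ adiniDof β (s, c) p = 0 ∧ adiniDof β (0, c) p = 0) :
    p = (1 - C (1 / s) * X 0) * (X 1 - C (2 / c) * X 1 ^ 2 + C (1 / c ^ 2) * X 1 ^ 3) := by
  obtain ⟨k, rfl⟩ := AdiniSpace.exists_coeffs hp
  have h00 := h₀ 0
  have h01 := h₀ 1
  have h02 := h₀ 2
  obtain ⟨a0, b0, d0⟩ := hv 0
  obtain ⟨a1, b1, d1⟩ := hv 1
  obtain ⟨a2, b2, d2⟩ := hv 2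
  simp [adiniDof, pev, dX, dY, Derivation.leibniz, Derivation.leibniz_pow, pderiv_X]
    at h00 h01 h02 a0 b0 d0 a1 b1 d1 a2 b2 d2
  rw [h00, h01, h02] at *
  have k6 : k 6 = 0 := by
    have : s ^ 3 * k 6 = 0 := by linear_combination s * a1 - 2 * a0
    simpa [hs] using this
  have k3 : k 3 = 0 := by
    have : s ^ 2 * k 3 = 0 := by linear_combination a0 - s ^ 3 * k6
    simpa [hs] using this
  have k9 : k 9 = 1 / c ^ 2 := by
    have : c * (c ^ 2 * k 9 - 1) = 0 := by linear_combination c * d2 - 2 * d0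
    field_simp
    linarith [(mul_eq_zero.mp this).resolve_left hc]
  have k5 : k 5 = -(2 / c) := by
    rw [k9] at d2
    field_simp at d2 ⊢
    linarith
  have k10 : k 10 = 0 := by
    have : s ^ 3 * c * k 10 = 0 := by
      linear_combination s * b1 - 2 * b0 + s * d1 + 2 * d0 - s ^ 3 * k6
    simpa [hs, hc] using this
  have k7 : k 7 = 0 := by
    have : s * c * k 7 = 0 := by
      linear_combination (b1 - d1) / 2 - s * k3 - 3 / 2 * s ^ 2 * k6 - 3 / 2 * s ^ 2 * c * k10
    simpa [hs, hc] using this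
  have k4 : k 4 = -(1 / s) := by
    rw [k7, k10] at a2
    field_simp
    linarith
  have sk4 : s * k 4 = -1 := by
    rw [k4]
    field_simp
  have sk11 : s * c ^ 2 * k 11 = -1 := by
    have : c * (s * c ^ 2 * k 11 + 1) = 0 := by
      linear_combination
        c * b2 - c * d2 - c * s ^ 2 * k7 - c * s ^ 3 * k10 - 2 * s * d1 + c * sk4
    linarith [(mul_eq_zero.mp this).resolve_left hc]
  have k11 : k 11 = -(1 / (s * c ^ 2)) := by
    field_simp
    linarith
  have k8 : k 8 = 2 / (s * c) := by
    have : c * (s * c * k 8 - 2) = 0 := by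
      linear_combination s * d1 - c * sk4 - c * sk11
    field_simp
    linarith [(mul_eq_zero.mp this).resolve_left hc]
  rw [k3, k4, k5, k6, k7, k8, k9, k10, k11]
  have e₁ : (1 / (s * c ^ 2) : ℝ) = 1 / s * (1 / c ^ 2) := by field_simp
  have e₂ : (2 / (s * c) : ℝ) = 1 / s * (2 / c) := by field_simp
  rw [e₁, e₂]
  simp only [C_neg, C_mul, C_0, C_1]
  ring

theorem dX_dX_adini (s c : ℝ) :
    dX (dX ((1 - C (1 / s) * X 0) *
      (X 1 - C (2 / c) * X 1 ^ 2 + C (1 / c ^ 2) * X 1 ^ 3))) = 0 := by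
  simp [dX, Derivation.leibniz, Derivation.leibniz_pow, pderiv_X]

theorem pev_dY_dX_adini (s c x y : ℝ) :
    pev x y (dY (dX ((1 - C (1 / s) * X 0) *
      (X 1 - C (2 / c) * X 1 ^ 2 + C (1 / c ^ 2) * X 1 ^ 3)))) =
      -(1 / s) * (1 - 4 * y / c + 3 * y ^ 2 / c ^ 2) := by
  simp [pev, dX, dY, Derivation.leibniz, Derivation.leibniz_pow, pderiv_X]
  left
  ring

/-- **Lemma l:varphiz01.** For the Adini basis functions `φ`, `ψ` of the degree
of freedom `∂_y` at the shared vertex `z = (0,0)` on `T = [0,a] × [0,c]` and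
`K = [−b,0] × [0,c]`: `∂²ₓₓφ = 0 = ∂²ₓₓψ` and, for any integrable `q = q(y)`,
`∫_{T∪K} q(y) ∂²ₓᵧ = 0`. -/
theorem adini_dy_orth (a b c : ℝ) (ha : 0 < a) (hb : 0 < b) (hc : 0 < c)
    (φ ψ : MvPolynomial (Fin 2) ℝ) (hφA : φ ∈ AdiniSpace) (hψA : ψ ∈ AdiniSpace)
    (hφ0 : ∀ β : Fin 3, adiniDof β (0, 0) φ = if β = 2 then 1 else 0)
    (hφv : ∀ β : Fin 3,
      adiniDof β (a, 0) φ = 0 ∧ adiniDof β (a, c) φ = 0 ∧ adiniDof β (0, c) φ = 0)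
    (hψ0 : ∀ β : Fin 3, adiniDof β (0, 0) ψ = if β = 2 then 1 else 0)
    (hψv : ∀ β : Fin 3,
      adiniDof β (-b, 0) ψ = 0 ∧ adiniDof β (-b, c) ψ = 0 ∧ adiniDof β (0, c) ψ = 0) :
    dX (dX φ) = 0 ∧ dX (dX ψ) = 0 ∧
    ∀ q : ℝ → ℝ, IntegrableOn q (Set.Icc 0 c) →
      (∫ x in (0 : ℝ)..a, ∫ y in (0 : ℝ)..c, q y * pev x y (dY (dX φ)))
        + (∫ x in (-b : ℝ)..0, ∫ y in (0 : ℝ)..c, q y * pev x y (dY (dX ψ))) = 0 := by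
  obtain rfl := AdiniSpace.eq_of_dof ha.ne' hc.ne' hφA hφ0 hφv
  obtain rfl := AdiniSpace.eq_of_dof (neg_ne_zero.mpr hb.ne') hc.ne' hψA hψ0 hψv
  refine ⟨dX_dX_adini a c, dX_dX_adini (-b) c, fun q _ => ?_⟩
  simp only [pev_dY_dX_adini, mul_left_comm (q _) (-(1 / _)),
    intervalIntegral.integral_const_mul, intervalIntegral.integral_const, smul_eq_mul]
  generalize ∫ y in (0 : ℝ)..c, q y * (1 - 4 * y / c + 3 * y ^ 2 / c ^ 2) = I
  field_simp
  ring
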